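/- Let X₁ and X₂ be independent random variables each with a log-concave, differentiable density f, let U = X₁ − X₂, and for b > 0 with P(0 < X < b) > 0 let g(u; b) denote the conditional density of U given 0 < X₁, X₂ < b. Then the Shannon differential entropy H(b) = −∫ g(u; b) log g(u; b) du is an increasing function of b; more generally, the Shannon information of U given X₁, X₂ ∈ A is partially increasing in the interval A. -/

import Mathlib

open MeasureTheory Set

lemma aux_entropy_le (p q : ℝ → ℝ) (K : ℝ) (hp0 : ∀ u, 0 ≤ p u) (hq0 : ∀ u, 0 ≤ q u)
    (hpi : Integrable p) (hqi : Integrable q) (hp1 : ∫ u, p u = 1) (hq1 : ∫ u, q u = 1)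
    (hK : ∀ u, p u ≤ K * q u)
    (hpl : Integrable (fun u => p u * Real.log (p u)))
    (hql : Integrable (fun u => q u * Real.log (q u)))
    (hanti : ∀ u v, |u| ≤ |v| → q v ≤ q u)
    (hmlr : ∀ u v, |u| ≤ |v| → p v * q u ≤ p u * q v) :
    - ∫ u, p u * Real.log (p u) ≤ - ∫ u, q u * Real.log (q u) := by
  have hz : ∀ u, q u = 0 → p u = 0 := fun u h => by
    have := hK u
    rw [h, mul_zero] at this
    exact le_antisymm this (hp0 u)
  have hqm : AEMeasurable q := hqi.aestronglyMeasurable.aemeasurable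
  have hx : Integrable (fun u => p u * Real.log (q u)) := by
    refine (hql.norm.const_mul K).mono' ?_ ?_
    · exact (hpi.aestronglyMeasurable.aemeasurable.mul
        (Real.measurable_log.comp_aemeasurable hqm)).aestronglyMeasurable
    · refine Filter.Eventually.of_forall fun u => ?_
      simp only [norm_mul, Real.norm_eq_abs, abs_of_nonneg (hp0 u), abs_of_nonneg (hq0 u)]
      rw [← mul_assoc]
      exact mul_le_mul_of_nonneg_right (hK u) (abs_nonneg _)
  have gibbs : ∫ u, p u * Real.log (q u) ≤ ∫ u, p u * Real.log (p u) := by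
    have h1 : ∫ u, (p u * Real.log (q u) + p u - q u) ≤ ∫ u, p u * Real.log (p u) := by
      refine integral_mono ((hx.add hpi).sub hqi) hpl fun u => ?_
      simp only
      rcases (hp0 u).eq_or_lt with h | h
      · rw [← h]; simpa using hq0 u
      · have hq : 0 < q u := lt_of_le_of_ne (hq0 u) fun h' => h.ne' (hz u h'.symm)
        have := Real.log_le_sub_one_of_pos (div_pos hq h)
        rw [Real.log_div hq.ne' h.ne'] at this
        have h2 := mul_le_mul_of_nonneg_left this h.le
        have h3 : p u * (q u / p u - 1) = q u - p u := by field_simp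
        rw [h3] at h2
        linarith
    have hxp : Integrable (fun u => p u * Real.log (q u) + p u) := hx.add hpi
    rw [integral_sub hxp hqi, integral_add hx hpi, hp1, hq1] at h1
    linarith
  have cheb : ∫ u, q u * Real.log (q u) ≤ ∫ u, p u * Real.log (q u) := by
    have i1 := hx.mul_prod hqi
    have i2 := hql.mul_prod hpi
    have i3 := hpi.mul_prod hql
    have i4 := hqi.mul_prod hx
    have h0 : 0 ≤ ∫ z : ℝ × ℝ, (((p z.1 * Real.log (q z.1)) * q z.2
        - (q z.1 * Real.log (q z.1)) * p z.2) - (p z.1 * (q z.2 * Real.log (q z.2))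
        - q z.1 * (p z.2 * Real.log (q z.2)))) ∂((volume : Measure ℝ).prod (volume : Measure ℝ)) := by
      refine integral_nonneg fun z => ?_
      obtain ⟨u, v⟩ := z
      simp only [Pi.zero_apply]
      have key : ∀ u v, |u| ≤ |v| →
          0 ≤ (Real.log (q u) - Real.log (q v)) * (p u * q v - p v * q u) := by
        intro u v huv
        rcases (hq0 v).eq_or_lt with h | h
        · rw [hz v h.symm, ← h]; simp
        · exact mul_nonneg (sub_nonneg.2 (Real.log_le_log h (hanti u v huv)))
            (sub_nonneg.2 (hmlr u v huv))
      rcases le_total |u| |v| with h | h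
      · have := key u v h
        linarith
      · have := key v u h
        linarith
    have i12 : Integrable (fun z : ℝ × ℝ => (p z.1 * Real.log (q z.1)) * q z.2
        - (q z.1 * Real.log (q z.1)) * p z.2) (volume.prod volume) := i1.sub i2
    have i34 : Integrable (fun z : ℝ × ℝ => p z.1 * (q z.2 * Real.log (q z.2))
        - q z.1 * (p z.2 * Real.log (q z.2))) (volume.prod volume) := i3.sub i4
    rw [integral_sub i12 i34, integral_sub i1 i2, integral_sub i3 i4,
      integral_prod_mul (fun u => p u * Real.log (q u)) q,
      integral_prod_mul (fun u => q u * Real.log (q u)) p,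
      integral_prod_mul p (fun u => q u * Real.log (q u)),
      integral_prod_mul q (fun u => p u * Real.log (q u)), hp1, hq1] at h0
    linarith
  linarith

/-- autocorrelation -/
noncomputable def auxN (h : ℝ → ℝ) (u : ℝ) : ℝ := ∫ x, h x * h (x - u)

lemma auxN_even (h : ℝ → ℝ) (u : ℝ) : auxN h (-u) = auxN h u := by
  unfold auxN
  rw [← integral_sub_right_eq_self (fun x => h x * h (x - -u)) u]
  congr 1; ext x; simp [mul_comm]

lemma auxN_abs (h : ℝ → ℝ) (u : ℝ) : auxN h |u| = auxN h u := by
  rcases abs_choice u with h' | h' <;> rw [h']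
  exact auxN_even h u

lemma auxN_neg (h : ℝ → ℝ) (u : ℝ) : auxN (fun x => h (-x)) u = auxN h u := by
  rw [← auxN_even]
  unfold auxN
  rw [← integral_neg_eq_self]
  congr 1; ext x; simp only [neg_neg]; congr 2; ring

lemma aux_exp_int {k : ℝ} (hk : 0 < k) : Integrable (fun x : ℝ => Real.exp (-k * |x|)) := by
  rw [← integrableOn_univ, ← Iic_union_Ioi (a := (0:ℝ))]
  refine IntegrableOn.union ?_ ?_
  · refine (integrableOn_exp_mul_Iic hk 0).congr_fun (fun x hx => ?_) measurableSet_Iic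
    simp only [abs_of_nonpos (show x ≤ 0 from hx)]; ring_nf
  · refine (integrableOn_exp_mul_Ioi (neg_lt_zero.2 hk) 0).congr_fun (fun x hx => ?_)
      measurableSet_Ioi
    simp only [abs_of_pos (show 0 < x from hx)]

structure AuxGood (h : ℝ → ℝ) : Prop where
  nonneg : ∀ x, 0 ≤ h x
  meas : Measurable h
  decay : ∃ C k : ℝ, 0 < k ∧ ∀ x, h x ≤ C * Real.exp (-k * |x|)
  fp : ∀ a b c d, a ≤ b → a ≤ c → a + d = b + c → h a * h d ≤ h b * h c

namespace AuxGood
variable {h : ℝ → ℝ}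

lemma integrable (g : AuxGood h) : Integrable h := by
  obtain ⟨C, k, hk, hC⟩ := g.decay
  refine ((aux_exp_int hk).const_mul C).mono' g.meas.aestronglyMeasurable
    (Filter.Eventually.of_forall fun x => ?_)
  rw [Real.norm_eq_abs, abs_of_nonneg (g.nonneg x)]
  exact hC x

lemma bdd (g : AuxGood h) : ∃ C, ∀ x, h x ≤ C := by
  obtain ⟨C, k, hk, hC⟩ := g.decay
  have hC0 : 0 ≤ C := by
    have := (g.nonneg 0).trans (hC 0)
    simpa using this
  refine ⟨C, fun x => (hC x).trans (mul_le_of_le_one_right hC0 ?_)⟩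
  rw [Real.exp_le_one_iff]
  have := mul_nonneg hk.le (abs_nonneg x)
  linarith

lemma int_mul (g : AuxGood h) {w : ℝ → ℝ} (hw : Integrable w) (u : ℝ) :
    Integrable (fun x => w x * h (x - u)) := by
  obtain ⟨C, hC⟩ := g.bdd
  refine hw.mul_bdd (c := C) (g.meas.comp (measurable_id.sub_const u)).aestronglyMeasurable
    (Filter.Eventually.of_forall fun x => ?_)
  rw [Real.norm_eq_abs, abs_of_nonneg (g.nonneg _)]
  exact hC _

lemma neg (g : AuxGood h) : AuxGood (fun x => h (-x)) := by
  refine ⟨fun x => g.nonneg _, g.meas.comp measurable_neg, ?_, ?_⟩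
  · obtain ⟨C, k, hk, hC⟩ := g.decay
    exact ⟨C, k, hk, fun x => by simpa using hC (-x)⟩
  · intro a b c d hb hc he
    rw [mul_comm (h (-a))]
    exact g.fp _ _ _ _ (by linarith) (by linarith) (by linarith)

lemma ind (g : AuxGood h) {A : Set ℝ} (hA : A.OrdConnected) : AuxGood (A.indicator h) := by
  have hm : MeasurableSet A := hA.measurableSet
  refine ⟨fun x => indicator_nonneg (fun x _ => g.nonneg x) x, g.meas.indicator hm, ?_, ?_⟩
  · obtain ⟨C, k, hk, hC⟩ := g.decay
    exact ⟨C, k, hk, fun x => (indicator_le_self' (fun x _ => g.nonneg x) x).trans (hC x)⟩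
  · intro a b c d hb hc he
    by_cases ha : a ∈ A
    · by_cases hd : d ∈ A
      · have hbA : b ∈ A := hA.out ha hd ⟨hb, by linarith⟩
        have hcA : c ∈ A := hA.out ha hd ⟨hc, by linarith⟩
        simp only [indicator_of_mem, ha, hd, hbA, hcA]
        exact g.fp _ _ _ _ hb hc he
      · rw [indicator_of_notMem hd, mul_zero]
        exact mul_nonneg (indicator_nonneg (fun x _ => g.nonneg x) _)
          (indicator_nonneg (fun x _ => g.nonneg x) _)
    · rw [indicator_of_notMem ha, zero_mul]
      exact mul_nonneg (indicator_nonneg (fun x _ => g.nonneg x) _)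
          (indicator_nonneg (fun x _ => g.nonneg x) _)

lemma N_nonneg (g : AuxGood h) (u : ℝ) : 0 ≤ auxN h u :=
  integral_nonneg fun x => mul_nonneg (g.nonneg _) (g.nonneg _)

lemma N_conv : auxN h = convolution h (fun x => h (-x)) (ContinuousLinearMap.mul ℝ ℝ) volume := by
  ext u
  rw [convolution_mul]
  simp [auxN]

lemma N_int (g : AuxGood h) : Integrable (auxN h) := by
  rw [N_conv]
  exact g.integrable.integrable_convolution _ g.neg.integrable

lemma N_integral (g : AuxGood h) : ∫ u, auxN h u = (∫ x, h x) ^ 2 := by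
  rw [N_conv, integral_convolution _ g.integrable g.neg.integrable, integral_neg_eq_self]
  simp [sq]

lemma N_shift (u : ℝ) : auxN h u = ∫ x, h (x + u / 2) * h (x - u / 2) := by
  unfold auxN
  rw [← integral_add_right_eq_self (fun x => h x * h (x - u)) (u / 2)]
  congr 1; ext x; congr 2; ring

lemma N_anti (g : AuxGood h) (u v : ℝ) (huv : |u| ≤ |v|) : auxN h v ≤ auxN h u := by
  rw [← auxN_abs h u, ← auxN_abs h v]
  generalize hu : |u| = u' at *
  generalize hv : |v| = v' at *
  have hu0 : 0 ≤ u' := hu ▸ abs_nonneg u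
  have hi : ∀ w : ℝ, Integrable fun x => h (x + w / 2) * h (x - w / 2) := fun w =>
    g.int_mul (g.integrable.comp_add_right (w / 2)) (w / 2)
  rw [N_shift, N_shift]
  refine integral_mono (hi _) (hi _) fun x => ?_
  simp only
  rw [mul_comm]
  exact g.fp _ _ _ _ (by linarith) (by linarith) (by ring)

lemma N_decay (g : AuxGood h) : ∃ D k : ℝ, 0 < k ∧ 0 ≤ D ∧
    ∀ u, auxN h u ≤ D * Real.exp (-k * |u|) := by
  obtain ⟨C, k, hk, hC⟩ := g.decay
  have hC0 : 0 ≤ C := by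
    have := (g.nonneg 0).trans (hC 0)
    simpa using this
  refine ⟨C ^ 2 * ∫ x, Real.exp (-(k / 2) * |x|), k / 2, half_pos hk,
    mul_nonneg (sq_nonneg _) (integral_nonneg fun x => (Real.exp_pos _).le), fun u => ?_⟩
  rw [mul_right_comm, ← integral_const_mul]
  refine integral_mono (g.int_mul g.integrable u)
    ((aux_exp_int (half_pos hk)).const_mul _) fun x => ?_
  simp only
  calc h x * h (x - u) ≤ (C * Real.exp (-k * |x|)) * (C * Real.exp (-k * |x - u|)) :=
        mul_le_mul (hC _) (hC _) (g.nonneg _) (mul_nonneg hC0 (Real.exp_pos _).le)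
    _ = C ^ 2 * Real.exp (-k * |x| + -k * |x - u|) := by rw [Real.exp_add]; ring
    _ ≤ C ^ 2 * Real.exp (-(k / 2) * |u| + -(k / 2) * |x|) := by
        refine mul_le_mul_of_nonneg_left (Real.exp_le_exp.2 ?_) (sq_nonneg _)
        have h1 : |u| ≤ |x| + |x - u| := by
          have := abs_sub x (x - u)
          simpa using this
        nlinarith [abs_nonneg (x - u), abs_nonneg x]
    _ = _ := by rw [Real.exp_add]; ring

end AuxGood

lemma aux_xlog (x : ℝ) (hx : 0 ≤ x) : |x * Real.log x| ≤ 2 * x ^ (1 / 2 : ℝ) + x ^ 2 := by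
  rcases hx.eq_or_lt with h | h
  · rw [← h]; simp
  rcases le_total x 1 with h1 | h1
  · have := Real.abs_log_mul_self_rpow_lt x (1 / 2) h h1 (by norm_num)
    have e : x * Real.log x = (Real.log x * x ^ (1 / 2 : ℝ)) * x ^ (1 / 2 : ℝ) := by
      rw [mul_assoc, ← Real.rpow_add h]; norm_num [mul_comm]
    have hp : 0 ≤ x ^ (1 / 2 : ℝ) := Real.rpow_nonneg hx _
    rw [e, abs_mul, abs_of_nonneg hp]
    nlinarith [sq_nonneg x]
  · rw [abs_of_nonneg (mul_nonneg hx (Real.log_nonneg h1))]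
    have hp : 0 ≤ x ^ (1 / 2 : ℝ) := Real.rpow_nonneg hx _
    nlinarith [Real.log_le_sub_one_of_pos h]

lemma aux_qlogq (q : ℝ → ℝ) (hqi : Integrable q) (hq0 : ∀ u, 0 ≤ q u) (D k : ℝ) (hk : 0 < k)
    (hD : 0 ≤ D) (hq : ∀ u, q u ≤ D * Real.exp (-k * |u|)) :
    Integrable (fun u => q u * Real.log (q u)) := by
  have hqm : AEMeasurable q := hqi.aestronglyMeasurable.aemeasurable
  refine (((aux_exp_int (half_pos hk)).const_mul (2 * D ^ (1 / 2 : ℝ))).add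
    ((aux_exp_int (mul_pos two_pos hk)).const_mul (D ^ 2))).mono'
    (hqm.mul (Real.measurable_log.comp_aemeasurable hqm)).aestronglyMeasurable
    (Filter.Eventually.of_forall fun u => ?_)
  refine (aux_xlog _ (hq0 u)).trans ?_
  simp only [Pi.add_apply]
  have h1 : q u ^ (1 / 2 : ℝ) ≤ D ^ (1 / 2 : ℝ) * Real.exp (-(k / 2) * |u|) := by
    refine (Real.rpow_le_rpow (hq0 u) (hq u) (by norm_num)).trans_eq ?_
    rw [Real.mul_rpow hD (Real.exp_pos _).le, ← Real.exp_mul]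
    congr 2; ring
  have h2 : q u ^ 2 ≤ D ^ 2 * Real.exp (-(2 * k) * |u|) := by
    refine (pow_le_pow_left₀ (hq0 u) (hq u) 2).trans_eq ?_
    rw [mul_pow, ← Real.exp_nat_mul]
    congr 2; push_cast; ring
  linarith

lemma aux_mlr_lower {h : ℝ → ℝ} (g : AuxGood h) {A : Set ℝ} (hA : MeasurableSet A)
    (hlow : ∀ x ∈ A, ∀ y, y ∉ A → h y ≠ 0 → x ≤ y) (u v : ℝ) (hu : 0 ≤ u) (huv : u ≤ v) :
    auxN (A.indicator h) v * auxN h u ≤ auxN (A.indicator h) u * auxN h v := by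
  have iA : Integrable (A.indicator h) := g.integrable.indicator hA
  have iC : Integrable (Aᶜ.indicator h) := g.integrable.indicator hA.compl
  have e1 : ∀ w, 0 ≤ w → auxN (A.indicator h) w = ∫ x, A.indicator h x * h (x - w) := by
    intro w hw
    unfold auxN
    congr 1; ext x
    by_cases hx : x ∈ A
    · by_cases hy : x - w ∈ A
      · rw [indicator_of_mem hy]
      · by_cases h0 : h (x - w) = 0
        · rw [indicator_of_notMem hy, h0]
        · have := hlow x hx _ hy h0
          have hw0 : w = 0 := by linarith
          subst hw0
          simp [hx] at hy
    · simp [hx]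
  have e2 : ∀ w, 0 ≤ w → auxN h w =
      auxN (A.indicator h) w + ∫ x, Aᶜ.indicator h x * h (x - w) := by
    intro w hw
    rw [e1 w hw, ← integral_add (g.int_mul iA w) (g.int_mul iC w)]
    unfold auxN
    congr 1; ext x
    by_cases hx : x ∈ A <;> simp [hx]
  have hv := hu.trans huv
  have key : (∫ x, A.indicator h x * h (x - v)) * (∫ x, Aᶜ.indicator h x * h (x - u)) ≤
      (∫ x, A.indicator h x * h (x - u)) * (∫ x, Aᶜ.indicator h x * h (x - v)) := by
    rw [← integral_prod_mul (fun x => A.indicator h x * h (x - v))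
        (fun x => Aᶜ.indicator h x * h (x - u)),
      ← integral_prod_mul (fun x => A.indicator h x * h (x - u))
        (fun x => Aᶜ.indicator h x * h (x - v))]
    refine integral_mono ((g.int_mul iA v).mul_prod (g.int_mul iC u))
      ((g.int_mul iA u).mul_prod (g.int_mul iC v)) fun z => ?_
    obtain ⟨x, y⟩ := z
    simp only
    by_cases hx : x ∈ A
    · by_cases hy : y ∈ A
      · simp [hy]
      · by_cases h0 : h y = 0
        · simp [h0, hy]
        · have hxy := hlow x hx y hy h0
          have := g.fp (x - v) (x - u) (y - v) (y - u) (by linarith) (by linarith) (by ring)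
          have h2 := mul_le_mul_of_nonneg_left this (mul_nonneg (g.nonneg x) (g.nonneg y))
          rw [indicator_of_mem hx, indicator_of_mem (show y ∈ Aᶜ from hy)]
          linarith
    · simp [hx]
  rw [e2 u hu, e2 v hv]
  rw [← e1 u hu, ← e1 v hv] at key
  linarith

lemma aux_mlr_upper {h : ℝ → ℝ} (g : AuxGood h) {A : Set ℝ} (hA : MeasurableSet A)
    (hup : ∀ x ∈ A, ∀ y, y ∉ A → h y ≠ 0 → y ≤ x) (u v : ℝ) (hu : 0 ≤ u) (huv : u ≤ v) :
    auxN (A.indicator h) v * auxN h u ≤ auxN (A.indicator h) u * auxN h v := by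
  have := aux_mlr_lower g.neg (A := Neg.neg ⁻¹' A) (measurable_neg hA)
    (fun x hx y hy h0 => by
      have := hup (-x) hx (-y) hy h0
      linarith) u v hu huv
  have e : (Neg.neg ⁻¹' A).indicator (fun x => h (-x)) = fun x => A.indicator h (-x) := by
    ext x; rfl
  rw [e] at this
  simpa only [auxN_neg] using this

/-- entropy of the difference -/
noncomputable def auxH (h : ℝ → ℝ) : ℝ :=
  - ∫ u, (auxN h u / (∫ x, h x) ^ 2) * Real.log (auxN h u / (∫ x, h x) ^ 2)

lemma aux_step {h : ℝ → ℝ} (g : AuxGood h) {A : Set ℝ} (hA : A.OrdConnected)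
    (hpos : 0 < ∫ x, A.indicator h x)
    (hmlr : ∀ u v : ℝ, 0 ≤ u → u ≤ v →
      auxN (A.indicator h) v * auxN h u ≤ auxN (A.indicator h) u * auxN h v) :
    auxH (A.indicator h) ≤ auxH h := by
  have gA := g.ind hA
  have hle : ∀ x, A.indicator h x ≤ h x := indicator_le_self' (fun x _ => g.nonneg x)
  have hpos' : 0 < ∫ x, h x := hpos.trans_le (integral_mono gA.integrable g.integrable hle)
  set a := ∫ x, A.indicator h x with ha
  set b := ∫ x, h x with hb
  have int1 : ∀ {w : ℝ → ℝ}, AuxGood w → ∀ c : ℝ, 0 < c →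
      Integrable (fun u => auxN w u / c * Real.log (auxN w u / c)) := by
    intro w gw c hc
    obtain ⟨D, k, hk, hD, hq⟩ := gw.N_decay
    refine aux_qlogq _ (gw.N_int.div_const c) (fun u => div_nonneg (gw.N_nonneg u) hc.le)
      (D / c) k hk (div_nonneg hD hc.le) fun u => ?_
    rw [div_mul_eq_mul_div]
    exact div_le_div_of_nonneg_right (hq u) hc.le
  have ha2 : 0 < a ^ 2 := pow_pos hpos 2
  have hb2 : 0 < b ^ 2 := pow_pos hpos' 2
  have hNle : ∀ u, auxN (A.indicator h) u ≤ auxN h u := fun u =>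
    integral_mono (gA.int_mul gA.integrable u) (g.int_mul g.integrable u) fun x =>
      mul_le_mul (hle _) (hle _) (gA.nonneg _) (g.nonneg _)
  unfold auxH
  rw [← ha, ← hb]
  refine aux_entropy_le (fun u => auxN (A.indicator h) u / a ^ 2) (fun u => auxN h u / b ^ 2)
    (b ^ 2 / a ^ 2) (fun u => div_nonneg (gA.N_nonneg u) ha2.le)
    (fun u => div_nonneg (g.N_nonneg u) hb2.le) (gA.N_int.div_const _) (g.N_int.div_const _)
    ?_ ?_ ?_ (int1 gA _ ha2) (int1 g _ hb2) ?_ ?_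
  · rw [integral_div, gA.N_integral, div_self ha2.ne']
  · rw [integral_div, g.N_integral, div_self hb2.ne']
  · intro u
    have e : b ^ 2 / a ^ 2 * (auxN h u / b ^ 2) = auxN h u / a ^ 2 := by field_simp
    simp only [e]
    exact div_le_div_of_nonneg_right (hNle u) ha2.le
  · intro u v huv
    exact div_le_div_of_nonneg_right (g.N_anti u v huv) hb2.le
  · intro u v huv
    have := hmlr |u| |v| (abs_nonneg u) huv
    simp only [auxN_abs] at this
    simp only [div_mul_div_comm]
    exact div_le_div_of_nonneg_right this (mul_pos ha2 hb2).le

lemma aux_chain {f : ℝ → ℝ} (g : AuxGood f) {A B : Set ℝ} (hA : A.OrdConnected)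
    (hB : B.OrdConnected) (hAB : A ⊆ B) (hpos : 0 < ∫ x, A.indicator f x) :
    auxH (A.indicator f) ≤ auxH (B.indicator f) := by
  set E : Set ℝ := {x | x ∈ B ∧ ∃ a ∈ A, x ≤ a} with hE
  have hAE : A ⊆ E := fun x hx => ⟨hAB hx, x, hx, le_rfl⟩
  have hEB : E ⊆ B := fun x hx => hx.1
  have hEo : E.OrdConnected := ⟨fun x hx y hy z hz => by
    obtain ⟨hyB, a, ha, hya⟩ := hy
    exact ⟨hB.out hx.1 hyB hz, a, ha, hz.2.trans hya⟩⟩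
  have eA : A.indicator (E.indicator f) = A.indicator f := by
    rw [indicator_indicator, inter_eq_left.2 hAE]
  have eE : E.indicator (B.indicator f) = E.indicator f := by
    rw [indicator_indicator, inter_eq_left.2 hEB]
  have gE := g.ind hEo
  have gB := g.ind hB
  have s1 : auxH (A.indicator (E.indicator f)) ≤ auxH (E.indicator f) := by
    refine aux_step gE hA (by rwa [eA]) (aux_mlr_upper gE hA.measurableSet ?_)
    intro x hx y hy h0
    have hyE : y ∈ E := mem_of_indicator_ne_zero h0
    obtain ⟨_, a, ha, hya⟩ := hyE
    by_contra! hlt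
    exact hy (hA.out hx ha ⟨hlt.le, hya⟩)
  have s2 : auxH (E.indicator (B.indicator f)) ≤ auxH (B.indicator f) := by
    refine aux_step gB hEo ?_ (aux_mlr_lower gB hEo.measurableSet ?_)
    · rw [eE]
      exact hpos.trans_le (integral_mono (g.ind hA).integrable gE.integrable
        (indicator_le_indicator_of_subset hAE g.nonneg))
    · intro x hx y hy h0
      have hyB : y ∈ B := mem_of_indicator_ne_zero h0
      obtain ⟨_, a, ha, hxa⟩ := hx
      by_contra! hlt
      exact hy ⟨hyB, a, ha, hlt.le.trans hxa⟩
  rw [eA] at s1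
  rw [eE] at s2
  exact s1.trans s2

lemma aux_decay_right (f : ℝ → ℝ) (hf0 : ∀ x, 0 ≤ f x) (hfint : ∫ x, f x = 1)
    (hlc : ∀ x y p q : ℝ, 0 ≤ p → 0 ≤ q → p + q = 1 →
      f x ^ p * f y ^ q ≤ f (p * x + q * y))
    (hc : Continuous f) : ∃ C k : ℝ, 0 < k ∧ ∀ x, 0 ≤ x → f x ≤ C * Real.exp (-k * x) := by
  have hi : Integrable f := integrable_of_integral_eq_one hfint
  obtain ⟨x0, hx0⟩ : ∃ x0, 0 < f x0 := by
    by_contra! hcon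
    have : f = fun _ => 0 := funext fun x => le_antisymm (hcon x) (hf0 x)
    rw [this] at hfint
    simp at hfint
  obtain ⟨x1, hx1, hlt⟩ : ∃ x1, x0 < x1 ∧ f x1 < f x0 := by
    by_contra! hcon
    have h1 : IntegrableOn (fun _ : ℝ => f x0) (Ioi x0) := by
      refine (hi.integrableOn (s := Ioi x0)).mono' aestronglyMeasurable_const ?_
      refine (ae_restrict_iff' measurableSet_Ioi).2 (Filter.Eventually.of_forall fun x hx => ?_)
      rw [Real.norm_eq_abs, abs_of_pos hx0]
      exact hcon x hx
    rw [integrableOn_const_iff (by simp)] at h1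
    simp [hx0.ne'] at h1
  obtain ⟨k, hk, hkb⟩ : ∃ k : ℝ, 0 < k ∧ ∀ x, x1 < x → f x ≤ f x0 * Real.exp (-k * (x - x0)) := by
    have main : ∀ x, x1 < x → 0 < f x → 0 < f x1 ∧
        Real.log (f x) ≤ Real.log (f x0) -
          (Real.log (f x0) - Real.log (f x1)) / (x1 - x0) * (x - x0) := by
      intro x hx hfx
      have d1 : 0 < x1 - x0 := by linarith
      have d2 : 0 < x - x0 := by linarith
      have d3 : 0 < x - x1 := by linarith
      have := hlc x0 x ((x - x1) / (x - x0)) ((x1 - x0) / (x - x0)) (by positivity)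
        (by positivity) (by field_simp; ring)
      have e : (x - x1) / (x - x0) * x0 + (x1 - x0) / (x - x0) * x = x1 := by
        field_simp; ring
      rw [e] at this
      have hp1 := Real.rpow_pos_of_pos hx0 ((x - x1) / (x - x0))
      have hp2 := Real.rpow_pos_of_pos hfx ((x1 - x0) / (x - x0))
      refine ⟨(mul_pos hp1 hp2).trans_le this, ?_⟩
      have h2 := Real.log_le_log (mul_pos hp1 hp2) this
      rw [Real.log_mul hp1.ne' hp2.ne', Real.log_rpow hx0, Real.log_rpow hfx] at h2
      generalize Real.log (f x0) = L0 at *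
      generalize Real.log (f x1) = L1 at *
      generalize Real.log (f x) = L at *
      rw [div_mul_eq_mul_div, div_mul_eq_mul_div, ← add_div, div_le_iff₀ d2] at h2
      rw [div_mul_eq_mul_div, le_sub_iff_add_le, ← le_sub_iff_add_le', div_le_iff₀ d1]
      nlinarith
    rcases (hf0 x1).eq_or_lt with h | h
    · refine ⟨1, one_pos, fun x hx => ?_⟩
      rcases (hf0 x).eq_or_lt with h' | h'
      · rw [← h']; positivity
      · have := (main x hx h').1
        linarith
    · refine ⟨(Real.log (f x0) - Real.log (f x1)) / (x1 - x0), div_pos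
        (sub_pos.2 (Real.log_lt_log h hlt)) (by linarith), fun x hx => ?_⟩
      rcases (hf0 x).eq_or_lt with h' | h'
      · rw [← h']; positivity
      · have := (main x hx h').2
        rw [Real.log_le_iff_le_exp h', Real.exp_sub, Real.exp_log hx0] at this
        rwa [neg_mul, Real.exp_neg, ← div_eq_mul_inv]
  have hco : ContinuousOn (fun x => f x * Real.exp (k * x)) (Icc 0 x1) := by fun_prop
  obtain ⟨S, hS⟩ := (isCompact_Icc.bddAbove_image hco)
  refine ⟨max S (f x0 * Real.exp (k * x0)), k, hk, fun x hx => ?_⟩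
  have hE := Real.exp_pos (-k * x)
  rcases le_or_gt x x1 with h | h
  · have h1 : f x * Real.exp (k * x) ≤ S := hS ⟨x, ⟨hx, h⟩, rfl⟩
    have h2 := mul_le_mul_of_nonneg_right (h1.trans (le_max_left S (f x0 * Real.exp (k * x0)))) hE.le
    rw [mul_assoc, ← Real.exp_add] at h2
    simpa using h2
  · refine (hkb x h).trans ?_
    have e : f x0 * Real.exp (-k * (x - x0)) = f x0 * Real.exp (k * x0) * Real.exp (-k * x) := by
      rw [mul_assoc, ← Real.exp_add]; congr 2; ring
    rw [e]
    exact mul_le_mul_of_nonneg_right (le_max_right _ _) hE.le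

lemma aux_good (f : ℝ → ℝ) (hf0 : ∀ x, 0 ≤ f x) (hfint : ∫ x, f x = 1)
    (hlc : ∀ x y p q : ℝ, 0 ≤ p → 0 ≤ q → p + q = 1 →
      f x ^ p * f y ^ q ≤ f (p * x + q * y))
    (hc : Continuous f) : AuxGood f := by
  refine ⟨hf0, hc.measurable, ?_, ?_⟩
  · obtain ⟨C, k, hk, h1⟩ := aux_decay_right f hf0 hfint hlc hc
    obtain ⟨C', k', hk', h2⟩ := aux_decay_right (fun x => f (-x)) (fun x => hf0 _)
      (by rw [integral_neg_eq_self, hfint])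
      (fun x y p q hp hq hpq => by
        have := hlc (-x) (-y) p q hp hq hpq
        have e : -(p * x + q * y) = p * -x + q * -y := by ring
        rwa [e]) (hc.comp continuous_neg)
    have hC0 : 0 ≤ C := by
      have := (hf0 0).trans (h1 0 le_rfl)
      simpa using this
    refine ⟨max C C', min k k', lt_min hk hk', fun x => ?_⟩
    rcases le_total 0 x with h | h
    · rw [abs_of_nonneg h]
      refine (h1 x h).trans (mul_le_mul (le_max_left _ _) (Real.exp_le_exp.2 ?_)
        (Real.exp_pos _).le (hC0.trans (le_max_left _ _)))
      nlinarith [min_le_left k k']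
    · rw [abs_of_nonpos h]
      have := h2 (-x) (by linarith)
      simp only [neg_neg] at this
      refine this.trans (mul_le_mul (le_max_right _ _) (Real.exp_le_exp.2 ?_)
        (Real.exp_pos _).le (hC0.trans (le_max_left _ _)))
      nlinarith [min_le_right k k']
  · intro a b c d hb hc' he
    have had : a ≤ d := by linarith
    rcases had.eq_or_lt with rfl | had
    · have e1 : b = a := by linarith
      have e2 : c = a := by linarith
      rw [e1, e2]
    have d0 : 0 < d - a := by linarith
    have hd : d = b + c - a := by linarith
    have hP : 0 ≤ (c - a) / (d - a) := div_nonneg (by linarith) d0.le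
    have hQ : 0 ≤ (b - a) / (d - a) := div_nonneg (by linarith) d0.le
    have hs : (c - a) / (d - a) + (b - a) / (d - a) = 1 := by
      rw [← add_div, div_eq_one_iff_eq d0.ne']; linarith
    have eb : (c - a) / (d - a) * a + (b - a) / (d - a) * d = b := by
      rw [div_mul_eq_mul_div, div_mul_eq_mul_div, ← add_div, div_eq_iff d0.ne', hd]; ring
    have ec : (b - a) / (d - a) * a + (c - a) / (d - a) * d = c := by
      rw [div_mul_eq_mul_div, div_mul_eq_mul_div, ← add_div, div_eq_iff d0.ne', hd]; ring
    have h1 := hlc a d _ _ hP hQ hs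
    have h2 := hlc a d _ _ hQ hP (by rw [add_comm]; exact hs)
    rw [eb] at h1
    rw [ec] at h2
    have h3 := mul_le_mul h1 h2 (mul_nonneg (Real.rpow_nonneg (hf0 _) _)
      (Real.rpow_nonneg (hf0 _) _)) (hf0 b)
    refine le_trans (le_of_eq ?_) h3
    rw [mul_mul_mul_comm, ← Real.rpow_add_of_nonneg (hf0 a) hP hQ,
      ← Real.rpow_add_of_nonneg (hf0 d) hQ hP, hs, add_comm, hs, Real.rpow_one, Real.rpow_one]

/-- Let `X₁, X₂` be i.i.d. with log-concave differentiable density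
`f`, and `U = X₁ - X₂`. For a set `A` (with `P(X ∈ A) > 0`), the conditional density
of `U` given `X₁, X₂ ∈ A` is
`g A u = (∫ x, 1_A f x * 1_A f (x - u) dx) / (∫_A f)²`, and its Shannon differential
entropy is `H A = -∫ g A u * log (g A u) du`. Then `b ↦ H ((0, b))` is increasing
(over `b > 0` with `P(0 < X < b) > 0`); more generally `H A ≤ H B` for intervals
`A ⊆ B`, i.e. the Shannon information of `U` given `X₁, X₂ ∈ A` is partially
increasing in the interval `A`. -/
theorem shannon_entropy_partially_increasing
    (f : ℝ → ℝ) (hf0 : ∀ x, 0 ≤ f x) (hfint : ∫ x, f x = 1)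
    (hlc : ∀ x y p q : ℝ, 0 ≤ p → 0 ≤ q → p + q = 1 →
      f x ^ p * f y ^ q ≤ f (p * x + q * y))
    (hdiff : Differentiable ℝ f)
    (g : Set ℝ → ℝ → ℝ)
    (hg : ∀ A u, g A u =
      (∫ x, A.indicator f x * A.indicator f (x - u)) / (∫ x in A, f x) ^ 2)
    (H : Set ℝ → ℝ)
    (hH : ∀ A, H A = - ∫ u, g A u * Real.log (g A u)) :
    MonotoneOn (fun b => H (Ioo 0 b))
      {b : ℝ | 0 < b ∧ 0 < ∫ x in Ioo (0 : ℝ) b, f x} ∧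
    (∀ A B : Set ℝ, A.OrdConnected → B.OrdConnected → A ⊆ B →
      (0 < ∫ x in A, f x) → H A ≤ H B) := by
  have good := aux_good f hf0 hfint hlc hdiff.continuous
  have hHe : ∀ A : Set ℝ, A.OrdConnected → H A = auxH (A.indicator f) := by
    intro A hA
    rw [hH, auxH]
    congr 2; ext u
    rw [hg, integral_indicator hA.measurableSet]
    rfl
  have main : ∀ A B : Set ℝ, A.OrdConnected → B.OrdConnected → A ⊆ B →
      (0 < ∫ x in A, f x) → H A ≤ H B := by
    intro A B hA hB hAB hpos
    rw [hHe A hA, hHe B hB]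
    exact aux_chain good hA hB hAB (by rwa [integral_indicator hA.measurableSet])
  refine ⟨fun b hb b' _ hbb => ?_, main⟩
  exact main _ _ ordConnected_Ioo ordConnected_Ioo (Ioo_subset_Ioo_right hbb) hb.2
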